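/- arXiv:1102.4673 — 5 statements merged into one kernel-verified Lean document; each statement's English description precedes it below -/
import Mathlib

section
/- Let n, ℓ ≥ 1 and let N be a real (2ℓ)×(2n) matrix. If there exists a continuous function F : ℂ^n → M((2ℓ)×(2n), ℝ) such that F(z) = N·T(z) for all z ∈ (ℂ*)^n, then N = 0. -/
open Matrix

/-- For `z = x+√-1·y ∈ ℂ*`, the real `2×2` matrix
`t(z) = (1/(x²+y²))·[[x, y],[−y, x]]` of the real-linear map `w ↦ w/z`. -/
noncomputable def tMat (z : ℂ) : Matrix (Fin 2) (Fin 2) ℝ :=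
  (z.re ^ 2 + z.im ^ 2)⁻¹ • !![z.re, z.im; -z.im, z.re]

/-- For `z = (z₁,…,zₙ) ∈ (ℂ*)^n`, the real `(2n)×(2n)` block-diagonal matrix
`T(z)` with `2×2` diagonal blocks `t(z₁),…,t(zₙ)`. -/
noncomputable def TMat {n : ℕ} (z : Fin n → ℂ) :
    Matrix (Fin 2 × Fin n) (Fin 2 × Fin n) ℝ :=
  Matrix.blockDiagonal fun i => tMat (z i)

/-- let `n, ℓ ≥ 1` and let `N` be a real `(2ℓ)×(2n)` matrix.  If
there exists a continuous function `F : ℂ^n → M((2ℓ)×(2n), ℝ)` such that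
`F(z) = N·T(z)` for all `z ∈ (ℂ*)^n`, then `N = 0`. -/
theorem eq_zero_of_continuous_extension_mul_TMat (n l : ℕ) (hn : 1 ≤ n) (hl : 1 ≤ l)
    (N : Matrix (Fin 2 × Fin l) (Fin 2 × Fin n) ℝ)
    (F : (Fin n → ℂ) → Matrix (Fin 2 × Fin l) (Fin 2 × Fin n) ℝ)
    (hF : Continuous F)
    (hFT : ∀ z : Fin n → ℂ, (∀ i, z i ≠ 0) → F z = N * TMat z) :
    N = 0 := by
  have hT : ∀ x : ℝ, x ≠ 0 → TMat (fun _ : Fin n => (x : ℂ)) = x⁻¹ • 1 := by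
    intro x hx
    have ht : tMat (x : ℂ) = x⁻¹ • (1 : Matrix (Fin 2) (Fin 2) ℝ) := by
      ext a b
      fin_cases a <;> fin_cases b <;> simp [tMat] <;> field_simp
    ext ⟨a, i⟩ ⟨b, j⟩
    simp only [TMat, ht, Matrix.blockDiagonal_apply, Matrix.smul_apply, Matrix.one_apply,
      Prod.mk.injEq]
    by_cases h1 : i = j <;> by_cases h2 : a = b <;> simp [h1, h2]
  ext p q
  have hc : Continuous fun x : ℝ => x * F (fun _ => (x : ℂ)) p q := by
    refine continuous_id.mul (Continuous.matrix_elem (hF.comp ?_) p q)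
    exact continuous_pi fun _ => Complex.continuous_ofReal
  have h0 : Filter.Tendsto (fun x : ℝ => x * F (fun _ => (x : ℂ)) p q)
      (nhdsWithin 0 {0}ᶜ) (nhds 0) := by
    have := (hc.tendsto 0).mono_left (nhdsWithin_le_nhds (s := {0}ᶜ))
    simpa using this
  have h1 : Filter.Tendsto (fun x : ℝ => x * F (fun _ => (x : ℂ)) p q)
      (nhdsWithin 0 {0}ᶜ) (nhds (N p q)) := by
    refine tendsto_const_nhds.congr' ?_
    filter_upwards [self_mem_nhdsWithin] with x hx
    have hx : x ≠ 0 := hx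
    rw [hFT _ (fun _ => by exact_mod_cast hx), hT x hx]
    simp [hx]
  simpa using tendsto_nhds_unique h1 h0
end

section
/- Let n ≥ 1 and let A be a real (2n)×(2n) matrix. If there exists a continuous function F : ℂ^n → M(2n, ℝ) such that F(z) = T(z)⁻¹·A·T(z) for all z ∈ (ℂ*)^n, then A·T(z) = T(z)·A for all z ∈ (ℂ*)^n, and F is the constant function with value A. -/
open Matrix

theorem tMat_isUnit_aux {n : ℕ} (z : Fin n → ℂ) (hz : ∀ i, z i ≠ 0) :
    TMat z * Matrix.blockDiagonal (fun i => !![(z i).re, -(z i).im; (z i).im, (z i).re]) = 1 := by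
  rw [TMat, ← Matrix.blockDiagonal_mul, ← Matrix.blockDiagonal_one]
  congr 1
  funext i
  have h : (z i).re ^ 2 + (z i).im ^ 2 ≠ 0 := by
    have := Complex.normSq_pos.mpr (hz i)
    rw [Complex.normSq_apply] at this
    nlinarith
  ext a b
  fin_cases a <;> fin_cases b <;>
    simp [tMat, Matrix.mul_apply, Fin.sum_univ_two] <;> field_simp <;> ring

theorem TMat_smul_aux {n : ℕ} (z : Fin n → ℂ) (s : ℝ) (hs : s ≠ 0) :
    TMat (s • z) = s⁻¹ • TMat z := by
  rw [TMat, TMat, ← Matrix.blockDiagonal_smul]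
  congr 1
  funext i
  have h : (s * (z i).re) ^ 2 + (s * (z i).im) ^ 2 =
    s ^ 2 * ((z i).re ^ 2 + (z i).im ^ 2) := by ring
  ext a b
  fin_cases a <;> fin_cases b <;>
    simp [tMat, h] <;> field_simp

theorem TMat_one_aux {n : ℕ} : TMat (fun _ : Fin n => (1 : ℂ)) = 1 := by
  rw [TMat, ← Matrix.blockDiagonal_one]
  congr 1
  funext i
  ext a b
  fin_cases a <;> fin_cases b <;> simp [tMat]

/-- let `n ≥ 1` and let `A` be a real `(2n)×(2n)` matrix.  If
there exists a continuous function `F : ℂ^n → M(2n, ℝ)` such that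
`F(z) = T(z)⁻¹·A·T(z)` for all `z ∈ (ℂ*)^n`, then `A·T(z) = T(z)·A` for all
`z ∈ (ℂ*)^n`, and `F` is the constant function with value `A`. -/
theorem commutes_of_continuous_conjugation (n : ℕ) (hn : 1 ≤ n)
    (A : Matrix (Fin 2 × Fin n) (Fin 2 × Fin n) ℝ)
    (F : (Fin n → ℂ) → Matrix (Fin 2 × Fin n) (Fin 2 × Fin n) ℝ)
    (hF : Continuous F)
    (hFT : ∀ z : Fin n → ℂ, (∀ i, z i ≠ 0) → F z = (TMat z)⁻¹ * A * TMat z) :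
    (∀ z : Fin n → ℂ, (∀ i, z i ≠ 0) → A * TMat z = TMat z * A) ∧
    (∀ z : Fin n → ℂ, F z = A) := by
  have hinv : ∀ z : Fin n → ℂ, (∀ i, z i ≠ 0) → TMat z * (TMat z)⁻¹ = 1 := by
    intro z hz
    rw [Matrix.inv_eq_right_inv (tMat_isUnit_aux z hz), tMat_isUnit_aux z hz]
  have hscale : ∀ z : Fin n → ℂ, (∀ i, z i ≠ 0) → ∀ s : ℝ, s ≠ 0 → F (s • z) = F z := by
    intro z hz s hs
    have h1 : (TMat (s • z))⁻¹ = s • (TMat z)⁻¹ := by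
      apply Matrix.inv_eq_right_inv
      rw [TMat_smul_aux z s hs, Matrix.smul_mul, Matrix.mul_smul, smul_smul,
        inv_mul_cancel₀ hs, one_smul, hinv z hz]
    rw [hFT z hz, hFT (s • z) (fun i => by simpa using ⟨hs, hz i⟩), h1, TMat_smul_aux z s hs,
      Matrix.smul_mul, Matrix.smul_mul, Matrix.mul_smul, smul_smul, mul_inv_cancel₀ hs, one_smul]
  have hzero : ∀ z : Fin n → ℂ, (∀ i, z i ≠ 0) → F z = F 0 := by
    intro z hz
    have hc : Continuous (fun s : ℝ => F (s • z)) := by fun_prop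
    have h := Continuous.ext_on (dense_compl_singleton (0 : ℝ)) hc
      (continuous_const (y := F z)) (fun s hs => hscale z hz s hs)
    have h0 := congrFun h 0
    simpa using h0.symm
  have hone : F 0 = A := by
    rw [← hzero (fun _ => 1) (fun _ => one_ne_zero), hFT _ (fun _ => one_ne_zero), TMat_one_aux]
    simp
  have hA : ∀ z : Fin n → ℂ, (∀ i, z i ≠ 0) → F z = A := fun z hz => (hzero z hz).trans hone
  refine ⟨fun z hz => ?_, fun z => ?_⟩
  · have h := hFT z hz
    rw [hA z hz] at h
    calc A * TMat z = (TMat z * (TMat z)⁻¹) * A * TMat z := by rw [hinv z hz, Matrix.one_mul]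
      _ = TMat z * ((TMat z)⁻¹ * A * TMat z) := by simp only [Matrix.mul_assoc]
      _ = TMat z * A := by rw [← h]
  · have hd : Dense (Set.pi Set.univ (fun _ : Fin n => ({0}ᶜ : Set ℂ))) :=
      dense_pi _ (fun _ _ => dense_compl_singleton (0 : ℂ))
    exact congrFun (Continuous.ext_on hd hF (continuous_const (y := A))
      (fun w hw => hA w (fun i => hw i (Set.mem_univ i)))) z
end

section
/- Let n ≥ 1 and let A be a real (2n)×(2n) matrix such that A·T(z) = T(z)·A for all z ∈ (ℂ*)^n and A² = −I_{2n}. Then A is block diagonal with each 2×2 diagonal block equal to [[0,−1],[1,0]] or to [[0,1],[−1,0]]. -/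
open Matrix

/-- let `n ≥ 1` and let `A` be a real `(2n)×(2n)` matrix such
that `A·T(z) = T(z)·A` for all `z ∈ (ℂ*)^n` and `A² = −I_{2n}`.  Then `A` is
block diagonal with each `2×2` diagonal block equal to `[[0,−1],[1,0]]` or to
`[[0,1],[−1,0]]`. -/
theorem blocks_of_commuting_complex_structure (n : ℕ) (hn : 1 ≤ n)
    (A : Matrix (Fin 2 × Fin n) (Fin 2 × Fin n) ℝ)
    (hcomm : ∀ z : Fin n → ℂ, (∀ i, z i ≠ 0) → A * TMat z = TMat z * A)
    (hA2 : A * A = -(1 : Matrix (Fin 2 × Fin n) (Fin 2 × Fin n) ℝ)) :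
    (∀ i j : Fin n, i ≠ j → ∀ p q : Fin 2, A (p, i) (q, j) = 0) ∧
    ∀ i : Fin n,
      (Matrix.of fun p q : Fin 2 => A (p, i) (q, i)) = !![0, -1; 1, 0] ∨
      (Matrix.of fun p q : Fin 2 => A (p, i) (q, i)) = !![0, 1; -1, 0] := by
  have key : ∀ (z : Fin n → ℂ), (∀ i, z i ≠ 0) → ∀ (p q : Fin 2) (i j : Fin n),
      ∑ r, A (p, i) (r, j) * tMat (z j) r q = ∑ r, tMat (z i) p r * A (r, i) (q, j) := by
    intro z hz p q i j
    have h := congrFun (congrFun (hcomm z hz) (p, i)) (q, j)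
    simpa [Matrix.mul_apply, TMat, Matrix.blockDiagonal_apply, Fintype.sum_prod_type,
      mul_ite, ite_mul, Finset.sum_ite_eq, Finset.sum_ite_eq'] using h
  have off : ∀ i j : Fin n, i ≠ j → ∀ p q : Fin 2, A (p, i) (q, j) = 0 := by
    intro i j hij p q
    have h := key (fun k => if k = i then -1 else 1)
      (by intro k; by_cases hk : k = i <;> simp [hk]) p q i j
    fin_cases p <;> fin_cases q <;>
      simp [tMat, Fin.sum_univ_two, hij.symm] at h ⊢ <;> linarith
  refine ⟨off, fun i => ?_⟩
  have hI := fun p q => key (fun _ => Complex.I) (fun _ => Complex.I_ne_zero) p q i i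
  have h00 := hI 0 0
  have h01 := hI 0 1
  simp [tMat, Fin.sum_univ_two] at h00 h01
  have sq : ∀ p q : Fin 2, ∑ r, A (p, i) (r, i) * A (r, i) (q, i)
      = -(1 : Matrix (Fin 2 × Fin n) (Fin 2 × Fin n) ℝ) (p, i) (q, i) := by
    intro p q
    have h := congrFun (congrFun hA2 (p, i)) (q, i)
    rw [Matrix.mul_apply, Fintype.sum_prod_type] at h
    rw [← Matrix.neg_apply, ← h]
    refine Finset.sum_congr rfl fun r _ => ?_
    rw [Finset.sum_eq_single i]
    · intro k _ hk
      rw [off i k hk.symm, zero_mul]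
    · simp
  have s00 := sq 0 0
  have s01 := sq 0 1
  simp [Fin.sum_univ_two, Matrix.one_apply] at s00 s01
  have hd : A (1, i) (1, i) = A (0, i) (0, i) := by linarith
  have hc : A (1, i) (0, i) = - A (0, i) (1, i) := by linarith
  rw [hc] at s00
  rw [hd] at s01
  have hab : A (0, i) (0, i) * A (0, i) (1, i) = 0 := by linarith
  have ha : A (0, i) (0, i) = 0 := by
    rcases mul_eq_zero.mp hab with h | h
    · exact h
    · rw [h] at s00
      nlinarith [mul_self_nonneg (A (0, i) (0, i))]
  rw [ha] at s00 hd
  have hb : A (0, i) (1, i) = 1 ∨ A (0, i) (1, i) = -1 :=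
    mul_self_eq_one_iff.mp (by linarith)
  rcases hb with hb | hb
  · right
    rw [hb] at hc
    ext p q
    fin_cases p <;> fin_cases q <;> simp [ha, hb, hc, hd]
  · left
    rw [hb] at hc
    ext p q
    fin_cases p <;> fin_cases q <;> simp [ha, hb, hc, hd]
end

section
/- (Matrix form of the key step of Theorem 1.) Let n, ℓ ≥ 1, let J₀ be a real (2n+2ℓ)×(2n+2ℓ) matrix written in blocks J₀ = [[J₁₁, J₁₂],[J₂₁, J₂₂]] with J₁₁ of size (2n)×(2n), J₁₂ of size (2n)×(2ℓ), J₂₁ of size (2ℓ)×(2n), J₂₂ of size (2ℓ)×(2ℓ), and let B be an invertible real (2n)×(2n) matrix. Suppose there exists a continuous function F : ℂ^n → M(2n+2ℓ, ℝ) such that for all z ∈ (ℂ*)^n, F(z) = diag((B·T(z))⁻¹, I_{2ℓ}) · J₀ · diag(B·T(z), I_{2ℓ}) (where diag(M, I_{2ℓ}) denotes the block-diagonal matrix with blocks M and the identity I_{2ℓ}). Then J₂₁ = 0. -/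
open Matrix

/-- matrix form of the key step of Theorem 1: let `n, ℓ ≥ 1`,
let `J₀` be a real `(2n+2ℓ)×(2n+2ℓ)` matrix with blocks
`J₀ = [[J₁₁, J₁₂],[J₂₁, J₂₂]]` (`J₁₁` of size `(2n)×(2n)`, `J₂₂` of size
`(2ℓ)×(2ℓ)`), and let `B` be an invertible real `(2n)×(2n)` matrix.  Suppose
there is a continuous `F : ℂ^n → M(2n+2ℓ, ℝ)` such that for all
`z ∈ (ℂ*)^n`,
`F(z) = diag((B·T(z))⁻¹, I_{2ℓ}) · J₀ · diag(B·T(z), I_{2ℓ})`.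
Then `J₂₁ = 0`. -/
theorem stably_complex_block_vanishes (n l : ℕ) (hn : 1 ≤ n) (hl : 1 ≤ l)
    (J11 : Matrix (Fin 2 × Fin n) (Fin 2 × Fin n) ℝ)
    (J12 : Matrix (Fin 2 × Fin n) (Fin 2 × Fin l) ℝ)
    (J21 : Matrix (Fin 2 × Fin l) (Fin 2 × Fin n) ℝ)
    (J22 : Matrix (Fin 2 × Fin l) (Fin 2 × Fin l) ℝ)
    (B : Matrix (Fin 2 × Fin n) (Fin 2 × Fin n) ℝ) (hB : IsUnit B)
    (F : (Fin n → ℂ) →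
      Matrix ((Fin 2 × Fin n) ⊕ (Fin 2 × Fin l)) ((Fin 2 × Fin n) ⊕ (Fin 2 × Fin l)) ℝ)
    (hF : Continuous F)
    (hFT : ∀ z : Fin n → ℂ, (∀ i, z i ≠ 0) →
      F z = Matrix.fromBlocks (B * TMat z)⁻¹ 0 0 1 *
        Matrix.fromBlocks J11 J12 J21 J22 * Matrix.fromBlocks (B * TMat z) 0 0 1) :
    J21 = 0 := by
  have hT : ∀ s : ℝ, s ≠ 0 → TMat (fun _ : Fin n => (s : ℂ)) = s⁻¹ • 1 := by
    intro s hs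
    have ht : tMat (s : ℂ) = s⁻¹ • 1 := by
      ext i j
      fin_cases i <;> fin_cases j <;> simp [tMat] <;> field_simp
    unfold TMat
    simp only [ht]
    ext ⟨i, i'⟩ ⟨j, j'⟩
    simp only [Matrix.blockDiagonal_apply, Matrix.smul_apply, Matrix.one_apply, Prod.mk.injEq,
      smul_eq_mul]
    split_ifs <;> simp_all
  have key : ∀ s : ℝ, s ≠ 0 → s • (F (fun _ => (s : ℂ))).toBlocks₂₁ = J21 * B := by
    intro s hs
    rw [hFT _ (fun _ => by exact_mod_cast hs), hT s hs]
    simp [Matrix.fromBlocks_multiply, smul_smul, hs]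
  have hc : Continuous fun s : ℝ => s • (F (fun _ => (s : ℂ))).toBlocks₂₁ := by
    refine continuous_id.smul ?_
    have h1 : Continuous fun s : ℝ => F (fun _ => (s : ℂ)) :=
      hF.comp (continuous_pi fun _ => Complex.continuous_ofReal)
    exact continuous_matrix fun i j => h1.matrix_elem _ _
  have h := Continuous.ext_on (dense_compl_singleton (0 : ℝ)) hc
    (continuous_const (y := J21 * B)) (fun s hs => key s hs)
  have h0 := congrFun h 0
  simp only [zero_smul] at h0
  have hdet := (Matrix.isUnit_iff_isUnit_det B).1 hB
  calc J21 = J21 * B * B⁻¹ := by rw [Matrix.mul_assoc, Matrix.mul_nonsing_inv _ hdet, Matrix.mul_one]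
    _ = 0 := by rw [← h0, Matrix.zero_mul]
end

section
/- (Matrix form of the key step of Theorem 2.) Let n ≥ 1, let J₀ be a real (2n)×(2n) matrix with J₀² = −I_{2n}, and let B be an invertible real (2n)×(2n) matrix. Suppose there exists a continuous function F : ℂ^n → M(2n, ℝ) such that F(z) = T(z)⁻¹·B⁻¹·J₀·B·T(z) for all z ∈ (ℂ*)^n. Then B⁻¹·J₀·B is block diagonal with each 2×2 diagonal block equal to [[0,−1],[1,0]] or to [[0,1],[−1,0]], and F is constant equal to B⁻¹·J₀·B. -/
open Matrix

theorem tMat_mul_aux (z : ℂ) (hz : z ≠ 0) :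
    tMat z * !![z.re, -z.im; z.im, z.re] = 1 := by
  have h : z.re ^ 2 + z.im ^ 2 ≠ 0 := by
    intro h
    apply hz
    apply Complex.ext
    · simp only [Complex.zero_re]; nlinarith [sq_nonneg z.re, sq_nonneg z.im]
    · simp only [Complex.zero_im]; nlinarith [sq_nonneg z.re, sq_nonneg z.im]
  ext p q
  fin_cases p <;> fin_cases q <;>
    simp [tMat, Matrix.mul_apply, Fin.sum_univ_two] <;> field_simp <;> ring

theorem TMat_isUnit {n : ℕ} (z : Fin n → ℂ) (hz : ∀ i, z i ≠ 0) :
    IsUnit (TMat z).det := by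
  have h : TMat z * Matrix.blockDiagonal
      (fun i => !![(z i).re, -(z i).im; (z i).im, (z i).re]) = 1 := by
    rw [TMat, ← Matrix.blockDiagonal_mul]
    simp only [fun i => tMat_mul_aux (z i) (hz i)]
    exact Matrix.blockDiagonal_one
  exact (Matrix.isUnit_iff_isUnit_det _).1 (IsUnit.of_mul_eq_one _ h)

theorem TMat_mul_apply {n : ℕ} (z : Fin n → ℂ)
    (M : Matrix (Fin 2 × Fin n) (Fin 2 × Fin n) ℝ) (p q : Fin 2) (i j : Fin n) :
    (TMat z * M) (p, i) (q, j) = ∑ r, tMat (z i) p r * M (r, i) (q, j) := by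
  simp [TMat, Matrix.mul_apply, Fintype.sum_prod_type, Matrix.blockDiagonal_apply, ite_mul]

theorem mul_TMat_apply {n : ℕ} (z : Fin n → ℂ)
    (M : Matrix (Fin 2 × Fin n) (Fin 2 × Fin n) ℝ) (p q : Fin 2) (i j : Fin n) :
    (M * TMat z) (p, i) (q, j) = ∑ r, M (p, i) (r, j) * tMat (z j) r q := by
  simp [TMat, Matrix.mul_apply, Fintype.sum_prod_type, Matrix.blockDiagonal_apply, mul_ite]

theorem tMat_ofReal (e : ℝ) (he : e ≠ 0) : tMat (e : ℂ) = e⁻¹ • 1 := by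
  ext p q
  fin_cases p <;> fin_cases q <;> simp [tMat] <;> field_simp

theorem tMat_ofReal_I (e : ℝ) (he : e ≠ 0) :
    tMat (e * Complex.I : ℂ) = e⁻¹ • !![0, 1; -1, 0] := by
  ext p q
  fin_cases p <;> fin_cases q <;> simp [tMat] <;> field_simp

/-- matrix form of the key step of Theorem 2: let `n ≥ 1`, let
`J₀` be a real `(2n)×(2n)` matrix with `J₀² = −I_{2n}`, and let `B` be an
invertible real `(2n)×(2n)` matrix.  Suppose there is a continuous
`F : ℂ^n → M(2n, ℝ)` such that `F(z) = T(z)⁻¹·B⁻¹·J₀·B·T(z)` for all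
`z ∈ (ℂ*)^n`.  Then `B⁻¹·J₀·B` is block diagonal with each `2×2` diagonal
block equal to `[[0,−1],[1,0]]` or to `[[0,1],[−1,0]]`, and `F` is constant
equal to `B⁻¹·J₀·B`. -/
theorem invariant_almost_complex_structure_is_standard (n : ℕ) (hn : 1 ≤ n)
    (J₀ : Matrix (Fin 2 × Fin n) (Fin 2 × Fin n) ℝ)
    (hJ₀ : J₀ * J₀ = -(1 : Matrix (Fin 2 × Fin n) (Fin 2 × Fin n) ℝ))
    (B : Matrix (Fin 2 × Fin n) (Fin 2 × Fin n) ℝ) (hB : IsUnit B)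
    (F : (Fin n → ℂ) → Matrix (Fin 2 × Fin n) (Fin 2 × Fin n) ℝ)
    (hF : Continuous F)
    (hFT : ∀ z : Fin n → ℂ, (∀ i, z i ≠ 0) →
      F z = (TMat z)⁻¹ * (B⁻¹ * J₀ * B) * TMat z) :
    (∀ i j : Fin n, i ≠ j → ∀ p q : Fin 2, (B⁻¹ * J₀ * B) (p, i) (q, j) = 0) ∧
    (∀ i : Fin n,
      (Matrix.of fun p q : Fin 2 => (B⁻¹ * J₀ * B) (p, i) (q, i)) = !![0, -1; 1, 0] ∨
      (Matrix.of fun p q : Fin 2 => (B⁻¹ * J₀ * B) (p, i) (q, i)) = !![0, 1; -1, 0]) ∧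
    (∀ z : Fin n → ℂ, F z = B⁻¹ * J₀ * B) := by
  have hA2 : (B⁻¹ * J₀ * B) * (B⁻¹ * J₀ * B) = -1 := by
    have hd := (Matrix.isUnit_iff_isUnit_det _).1 hB
    calc (B⁻¹ * J₀ * B) * (B⁻¹ * J₀ * B) = B⁻¹ * J₀ * (B * B⁻¹) * J₀ * B := by
          simp only [Matrix.mul_assoc]
      _ = B⁻¹ * (J₀ * J₀) * B := by
          rw [Matrix.mul_nonsing_inv _ hd]; simp only [Matrix.mul_assoc, Matrix.one_mul]
      _ = -1 := by rw [hJ₀]; simp [Matrix.nonsing_inv_mul _ hd]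
  generalize B⁻¹ * J₀ * B = A at *
  have key : ∀ z : Fin n → ℂ, (∀ i, z i ≠ 0) → TMat z * F z = A * TMat z := by
    intro z hz
    rw [hFT z hz, ← Matrix.mul_assoc, ← Matrix.mul_assoc,
      Matrix.mul_nonsing_inv _ (TMat_isUnit z hz), Matrix.one_mul]
  have keye : ∀ z : Fin n → ℂ, (∀ i, z i ≠ 0) → ∀ p q i j,
      ∑ r, tMat (z i) p r * F z (r, i) (q, j) = ∑ r, A (p, i) (r, j) * tMat (z j) r q := by
    intro z hz p q i j
    rw [← TMat_mul_apply, key z hz, mul_TMat_apply]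
  have hFe : ∀ a b, Continuous fun z => F z a b := fun a b => hF.matrix_elem a b
  have lim : ∀ (f : ℝ → ℝ) (c : ℝ), Continuous f → (∀ e, e ≠ 0 → f e = c) → f 0 = c := by
    intro f c hf h
    exact congrFun (Continuous.ext_on (dense_compl_singleton (0 : ℝ)) hf
      (continuous_const (y := c)) (fun e he => h e he)) 0
  have hoff : ∀ i j : Fin n, i ≠ j → ∀ p q : Fin 2, A (p, i) (q, j) = 0 := by
    intro i j hij p q
    have := lim (fun e => e * F (fun k => if k = j then (e : ℂ) else 1) (p, i) (q, j))
      (A (p, i) (q, j)) ?_ ?_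
    · simpa using this.symm
    · refine continuous_id.mul ((hFe _ _).comp (continuous_pi fun k => ?_))
      by_cases hk : k = j
      · simpa [hk] using Complex.continuous_ofReal
      · simpa [hk] using continuous_const
    · intro e he
      have h := keye (fun k => if k = j then (e : ℂ) else 1)
        (by intro k; by_cases hk : k = j <;> simp [hk, he]) p q i j
      have h1 : tMat 1 = 1 := by simpa using tMat_ofReal 1 one_ne_zero
      simp only [hij, if_false, if_true, h1, tMat_ofReal e he] at h
      simp [Matrix.one_apply] at h
      simp only [h]
      field_simp
  have hF0 : ∀ a b, F 0 a b = A a b := by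
    rintro ⟨p, i⟩ ⟨q, j⟩
    have := lim (fun e => F (fun k => (e : ℂ)) (p, i) (q, j)) (A (p, i) (q, j)) ?_ ?_
    · simp only [Complex.ofReal_zero] at this
      exact this
    · exact (hFe _ _).comp (continuous_pi fun k => Complex.continuous_ofReal)
    · intro e he
      have h := keye (fun k => (e : ℂ)) (by simp [he]) p q i j
      simp only [tMat_ofReal e he] at h
      simp [Matrix.one_apply] at h
      rw [mul_comm] at h
      exact mul_right_cancel₀ (inv_ne_zero he) h
  have hI : ∀ p q i j, ∑ r, (!![0, 1; -1, 0] : Matrix (Fin 2) (Fin 2) ℝ) p r * A (r, i) (q, j)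
      = ∑ r, A (p, i) (r, j) * (!![0, 1; -1, 0] : Matrix (Fin 2) (Fin 2) ℝ) r q := by
    intro p q i j
    have := lim (fun e => ∑ r, (!![0, 1; -1, 0] : Matrix (Fin 2) (Fin 2) ℝ) p r *
      F (fun k => (e * Complex.I : ℂ)) (r, i) (q, j)) 
      (∑ r, A (p, i) (r, j) * (!![0, 1; -1, 0] : Matrix (Fin 2) (Fin 2) ℝ) r q) ?_ ?_
    · rw [← this]
      refine Finset.sum_congr rfl fun r _ => ?_
      rw [← hF0]
      congr 2
      simp
      rfl
    · refine continuous_finsetSum _ fun r _ => continuous_const.mul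
        ((hFe _ _).comp (continuous_pi fun k => ?_))
      exact Complex.continuous_ofReal.mul continuous_const
    · intro e he
      have h := keye (fun k => (e * Complex.I : ℂ)) (by simp [he]) p q i j
      simp only [tMat_ofReal_I e he, Matrix.smul_apply, smul_eq_mul, mul_assoc,
        mul_left_comm _ e⁻¹, ← Finset.mul_sum] at h
      exact mul_left_cancel₀ (inv_ne_zero he) h
  have hsh : ∀ i, A (1, i) (0, i) = -A (0, i) (1, i) ∧ A (1, i) (1, i) = A (0, i) (0, i) := by
    intro i
    have h1 := hI 0 0 i i
    have h2 := hI 0 1 i i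
    simp [Fin.sum_univ_two] at h1 h2
    exact ⟨h1, h2⟩
  have hsq : ∀ i p q, ∑ r, A (p, i) (r, i) * A (r, i) (q, i) = -(1 : Matrix (Fin 2) (Fin 2) ℝ) p q := by
    intro i p q
    have h := congrFun (congrFun hA2 (p, i)) (q, i)
    rw [Matrix.mul_apply, Fintype.sum_prod_type] at h
    have h3 : ∀ r, ∑ k, A (p, i) (r, k) * A (r, k) (q, i) = A (p, i) (r, i) * A (r, i) (q, i) := by
      intro r
      refine Finset.sum_eq_single i (fun k _ hk => ?_) (by simp)
      rw [hoff i k (Ne.symm hk), zero_mul]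
    simp only [h3] at h
    rw [h]
    simp [Matrix.one_apply]
  have hdiag : ∀ i, A (0, i) (0, i) = 0 ∧ A (0, i) (1, i) ^ 2 = 1 := by
    intro i
    obtain ⟨h1, h2⟩ := hsh i
    have h3 := hsq i 0 0
    have h4 := hsq i 0 1
    simp [Fin.sum_univ_two, h1, h2] at h3 h4
    have h5 : A (0, i) (0, i) * A (0, i) (1, i) = 0 := by linarith
    rcases mul_eq_zero.1 h5 with h | h
    · refine ⟨h, ?_⟩
      rw [h] at h3; nlinarith
    · rw [h] at h3; nlinarith
  refine ⟨hoff, fun i => ?_, ?_⟩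
  · obtain ⟨h1, h2⟩ := hsh i
    obtain ⟨h3, h4⟩ := hdiag i
    rcases (mul_self_eq_one_iff.1 ((sq _).symm.trans h4)) with h | h
    · right
      ext p q
      fin_cases p <;> fin_cases q <;> simp [h1, h2, h3, h]
    · left
      ext p q
      fin_cases p <;> fin_cases q <;> simp [h1, h2, h3, h]
  · have hcomm : ∀ z : Fin n → ℂ, A * TMat z = TMat z * A := by
      intro z
      ext ⟨p, i⟩ ⟨q, j⟩
      rw [TMat_mul_apply, mul_TMat_apply]
      by_cases hij : i = j
      · subst hij
        obtain ⟨h1, h2⟩ := hsh i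
        fin_cases p <;> fin_cases q <;> simp [Fin.sum_univ_two, tMat, h1, h2] <;> ring
      · simp [hoff i j hij]
    have hd : Dense (Set.pi Set.univ fun _ : Fin n => ({0}ᶜ : Set ℂ)) :=
      dense_pi _ fun _ _ => dense_compl_singleton 0
    intro z
    refine congrFun (Continuous.ext_on hd hF (continuous_const (y := A)) fun w hw => ?_) z
    have hw' : ∀ i, w i ≠ 0 := fun i => hw i (Set.mem_univ i)
    rw [hFT w hw', Matrix.mul_assoc, hcomm, ← Matrix.mul_assoc,
      Matrix.nonsing_inv_mul _ (TMat_isUnit w hw'), Matrix.one_mul]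
end
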